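/- arXiv:2512.15402 — 2 statements merged into one kernel-verified Lean document; each statement's English description precedes it below -/
import Mathlib

section
/- Let n ≥ 1 and let Ψ : Conv(ℝⁿ,ℝ) → M(ℝⁿ) be a continuous local functional. Then Ψ is a valuation: for all f, h ∈ Conv(ℝⁿ,ℝ) such that the pointwise minimum f ∧ h is convex, one has Ψ(f ∨ h) + Ψ(f ∧ h) = Ψ(f) + Ψ(h), where f ∨ h denotes the pointwise maximum. -/
open scoped CompactlySupported

noncomputable section

/-- `ℝⁿ` with its Euclidean structure. -/
abbrev Eucl (n : ℕ) := EuclideanSpace ℝ (Fin n)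

/-- The space of complex Radon measures on `ℝⁿ`, identified with the topological dual of
`C_c(ℝⁿ, ℂ)`: linear functionals bounded on the subspace of functions supported in any
fixed compact set. -/
def RadonMeasure (n : ℕ) : Submodule ℂ (C_c(Eucl n, ℂ) →ₗ[ℂ] ℂ) where
  carrier := {μ | ∀ A : Set (Eucl n), IsCompact A → ∃ C : ℝ, ∀ φ : C_c(Eucl n, ℂ),
      tsupport ⇑φ ⊆ A → (∀ x, ‖φ x‖ ≤ 1) → ‖μ φ‖ ≤ C}
  add_mem' := by
    intro μ ν hμ hν A hA
    obtain ⟨C₁, h₁⟩ := hμ A hA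
    obtain ⟨C₂, h₂⟩ := hν A hA
    refine ⟨C₁ + C₂, fun φ h h' => ?_⟩
    calc ‖(μ + ν) φ‖ = ‖μ φ + ν φ‖ := by simp
    _ ≤ ‖μ φ‖ + ‖ν φ‖ := norm_add_le _ _
    _ ≤ C₁ + C₂ := add_le_add (h₁ φ h h') (h₂ φ h h')
  zero_mem' := fun _ _ => ⟨0, fun φ _ _ => by simp⟩
  smul_mem' := by
    intro c μ hμ A hA
    obtain ⟨C, h⟩ := hμ A hA
    refine ⟨‖c‖ * C, fun φ hs hb => ?_⟩
    simp only [LinearMap.smul_apply, norm_smul]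
    exact mul_le_mul_of_nonneg_left (h φ hs hb) (norm_nonneg c)

/-- The space `Conv(ℝⁿ, ℝ)` of (finite, hence continuous) convex functions on `ℝⁿ`, carrying
the topology of uniform convergence on compact subsets (the compact-open topology). -/
abbrev ConvFn (n : ℕ) := {f : C(Eucl n, ℝ) // ConvexOn ℝ Set.univ ⇑f}

/-- `Ψ` is a local functional: the associated measures agree (i.e. give the same integral to
every test function supported there) on every open set where the convex functions agree. -/
def IsLocalFunctional {n : ℕ} (Ψ : ConvFn n → RadonMeasure n) : Prop :=
  ∀ (f h : ConvFn n) (U : Set (Eucl n)), IsOpen U → (∀ x ∈ U, f.1 x = h.1 x) →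
    ∀ φ : C_c(Eucl n, ℂ), tsupport ⇑φ ⊆ U → (Ψ f).1 φ = (Ψ h).1 φ

/-- Continuity of a measure-valued functional on `Conv(ℝⁿ,ℝ)`: `f ↦ Ψ(f)(φ)` is continuous
with respect to locally uniform convergence for every test function `φ` (weak* continuity). -/
def IsContinuousFunctional {n : ℕ} (Ψ : ConvFn n → RadonMeasure n) : Prop :=
  ∀ φ : C_c(Eucl n, ℂ), Continuous fun f : ConvFn n => (Ψ f).1 φ

/-- Truncation from below by `m + t`. -/
def trunc {n : ℕ} (m : ConvFn n) (u : ConvFn n) (t : ℝ) : ConvFn n :=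
  ⟨u.1 ⊔ (m.1 + ContinuousMap.const _ t), u.2.sup (m.2.add (convexOn_const t convex_univ))⟩

theorem trunc_apply {n : ℕ} (m u : ConvFn n) (t : ℝ) (x : Eucl n) :
    (trunc m u t).1 x = max (u.1 x) (m.1 x + t) := rfl

theorem trunc_zero {n : ℕ} (m u : ConvFn n) (hu : ∀ x, m.1 x ≤ u.1 x) : trunc m u 0 = u := by
  apply Subtype.ext
  ext x
  rw [trunc_apply, add_zero, max_eq_left (hu x)]

theorem trunc_cont {n : ℕ} (m u : ConvFn n) : Continuous (trunc m u) := by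
  refine Continuous.subtype_mk ?_ _
  apply ContinuousMap.continuous_of_continuous_uncurry
  change Continuous fun p : ℝ × Eucl n => max (u.1 p.2) (m.1 p.2 + p.1)
  fun_prop

/-- Multiply a test function by `w ∘ d`. -/
def wmul {n : ℕ} (w : C(ℝ, ℝ)) (d : C(Eucl n, ℝ)) (φ : C_c(Eucl n, ℂ)) : C_c(Eucl n, ℂ) where
  toFun x := (w (d x) : ℂ) * φ x
  continuous_toFun := by fun_prop
  hasCompactSupport' := φ.hasCompactSupport.mul_left

theorem wmul_tsupport {n : ℕ} (w : C(ℝ, ℝ)) (d : C(Eucl n, ℝ)) (φ : C_c(Eucl n, ℂ))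
    (S : Set ℝ) (hS : IsClosed S) (hw : ∀ r, r ∉ S → w r = 0) :
    tsupport ⇑(wmul w d φ) ⊆ d ⁻¹' S := by
  apply closure_minimal _ (hS.preimage d.continuous)
  intro x hx
  by_contra h
  apply hx
  change (w (d x) : ℂ) * φ x = 0
  rw [hw _ h]; simp

theorem key {n : ℕ} (Ψ : ConvFn n → RadonMeasure n) (hloc : IsLocalFunctional Ψ)
    (f h m M : ConvFn n) (hm : ∀ x, m.1 x = min (f.1 x) (h.1 x))
    (hM : ∀ x, M.1 x = max (f.1 x) (h.1 x)) (φ : C_c(Eucl n, ℂ)) (δ : ℝ) (hδ : 0 < δ) :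
    (Ψ (trunc m M (3 * δ))).1 φ + (Ψ (trunc m m (3 * δ))).1 φ
      = (Ψ (trunc m f (3 * δ))).1 φ + (Ψ (trunc m h (3 * δ))).1 φ := by
  let d : C(Eucl n, ℝ) := f.1 - h.1
  have hd : ∀ x, d x = f.1 x - h.1 x := fun x => rfl
  let w₁ : C(ℝ, ℝ) := ⟨fun r => min 1 (max 0 (-r / δ - 1)), by fun_prop⟩
  let w₂ : C(ℝ, ℝ) := ⟨fun r => min 1 (max 0 (r / δ - 1)), by fun_prop⟩
  let w₃ : C(ℝ, ℝ) := 1 - w₁ - w₂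
  have e₁ : ∀ r, w₁ r = min 1 (max 0 (-r / δ - 1)) := fun r => rfl
  have e₂ : ∀ r, w₂ r = min 1 (max 0 (r / δ - 1)) := fun r => rfl
  have e₃ : ∀ r, w₃ r = 1 - w₁ r - w₂ r := fun r => rfl
  have z₁ : ∀ r, -δ ≤ r → w₁ r = 0 := by
    intro r hr
    have : -r / δ ≤ 1 := by rw [div_le_one hδ]; linarith
    rw [e₁, max_eq_left (by linarith)]; simp
  have z₂ : ∀ r, r ≤ δ → w₂ r = 0 := by
    intro r hr
    have : r / δ ≤ 1 := by rw [div_le_one hδ]; linarith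
    rw [e₂, max_eq_left (by linarith)]; simp
  have o₁ : ∀ r, r ≤ -(2 * δ) → w₁ r = 1 := by
    intro r hr
    have : 2 ≤ -r / δ := by rw [le_div_iff₀ hδ]; linarith
    rw [e₁, max_eq_right (by linarith), min_eq_left (by linarith)]
  have o₂ : ∀ r, 2 * δ ≤ r → w₂ r = 1 := by
    intro r hr
    have : 2 ≤ r / δ := by rw [le_div_iff₀ hδ]; linarith
    rw [e₂, max_eq_right (by linarith), min_eq_left (by linarith)]
  have s₁ := wmul_tsupport w₁ d φ (Set.Iic (-δ)) isClosed_Iic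
    (fun r hr => z₁ r (by simp at hr; linarith))
  have s₂ := wmul_tsupport w₂ d φ (Set.Ici δ) isClosed_Ici
    (fun r hr => z₂ r (by simp at hr; linarith))
  have s₃ := wmul_tsupport w₃ d φ (Set.Icc (-(2 * δ)) (2 * δ)) isClosed_Icc (by
    intro r hr
    rw [e₃]
    by_cases h1 : r ≤ -(2 * δ)
    · rw [o₁ r h1, z₂ r (by linarith)]; ring
    · by_cases h2 : 2 * δ ≤ r
      · rw [o₂ r h2, z₁ r (by linarith)]; ring
      · exact absurd ⟨(not_le.1 h1).le, (not_le.1 h2).le⟩ hr)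
  have hsum : φ = wmul w₁ d φ + wmul w₂ d φ + wmul w₃ d φ := by
    ext x
    change φ x = (w₁ (d x) : ℂ) * φ x + (w₂ (d x) : ℂ) * φ x + (w₃ (d x) : ℂ) * φ x
    rw [e₃]; push_cast; ring
  have hU₁ : IsOpen {x | d x < 0} := isOpen_lt d.continuous continuous_const
  have hU₂ : IsOpen {x | 0 < d x} := isOpen_lt continuous_const d.continuous
  have hU₃ : IsOpen {x | |d x| < 3 * δ} := isOpen_lt d.continuous.abs continuous_const
  have t₁ : tsupport ⇑(wmul w₁ d φ) ⊆ {x | d x < 0} := fun x hx => by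
    have := s₁ hx
    simp only [Set.mem_preimage, Set.mem_Iic] at this
    simp only [Set.mem_setOf_eq]; linarith
  have t₂ : tsupport ⇑(wmul w₂ d φ) ⊆ {x | 0 < d x} := fun x hx => by
    have := s₂ hx
    simp only [Set.mem_preimage, Set.mem_Ici] at this
    simp only [Set.mem_setOf_eq]; linarith
  have t₃ : tsupport ⇑(wmul w₃ d φ) ⊆ {x | |d x| < 3 * δ} := fun x hx => by
    have := s₃ hx
    simp only [Set.mem_preimage, Set.mem_Icc] at this
    simp only [Set.mem_setOf_eq, abs_lt]; constructor <;> linarith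
  have a₁ := hloc (trunc m M (3 * δ)) (trunc m h (3 * δ)) _ hU₁ (fun x hx => by
    simp only [Set.mem_setOf_eq, hd] at hx
    rw [trunc_apply, trunc_apply, hM, max_eq_right (a := f.1 x) (by linarith)]) _ t₁
  have b₁ := hloc (trunc m m (3 * δ)) (trunc m f (3 * δ)) _ hU₁ (fun x hx => by
    simp only [Set.mem_setOf_eq, hd] at hx
    rw [trunc_apply, trunc_apply, hm, min_eq_left (by linarith)]) _ t₁
  have a₂ := hloc (trunc m M (3 * δ)) (trunc m f (3 * δ)) _ hU₂ (fun x hx => by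
    simp only [Set.mem_setOf_eq, hd] at hx
    rw [trunc_apply, trunc_apply, hM, max_eq_left (a := f.1 x) (by linarith)]) _ t₂
  have b₂ := hloc (trunc m m (3 * δ)) (trunc m h (3 * δ)) _ hU₂ (fun x hx => by
    simp only [Set.mem_setOf_eq, hd] at hx
    rw [trunc_apply, trunc_apply, hm, min_eq_right (by linarith)]) _ t₂
  have c₃ : ∀ u : ConvFn n, (∀ x, u.1 x ≤ M.1 x) →
      (Ψ (trunc m u (3 * δ))).1 (wmul w₃ d φ) = (Ψ (trunc m m (3 * δ))).1 (wmul w₃ d φ) := by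
    intro u hu
    refine hloc _ _ _ hU₃ (fun x hx => ?_) _ t₃
    simp only [Set.mem_setOf_eq, hd, abs_lt] at hx
    have h1 := hu x
    have h2 : M.1 x ≤ m.1 x + 3 * δ := by
      rw [hM, hm]
      rcases le_total (f.1 x) (h.1 x) with h | h
      · rw [max_eq_right h, min_eq_left h]; linarith
      · rw [max_eq_left h, min_eq_right h]; linarith
    rw [trunc_apply, trunc_apply, max_eq_right (by linarith), max_eq_right (by linarith)]
  have c₁ := c₃ M (fun x => le_rfl)
  have c₂ := c₃ f (fun x => by rw [hM]; exact le_max_left _ _)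
  have c₄ := c₃ h (fun x => by rw [hM]; exact le_max_right _ _)
  rw [hsum]
  simp only [map_add]
  rw [a₁, b₁, a₂, b₂, c₁, c₂, c₄]
  ring

/-- Every continuous local functional on `Conv(ℝⁿ,ℝ)` with values in the
space of complex Radon measures is a valuation: whenever the pointwise minimum `f ⊓ h` of two
convex functions is convex, `Ψ(f ⊔ h) + Ψ(f ⊓ h) = Ψ(f) + Ψ(h)`. -/
theorem localFunctional_is_valuation {n : ℕ} (hn : 1 ≤ n)
    (Ψ : ConvFn n → RadonMeasure n)
    (hloc : IsLocalFunctional Ψ) (hcont : IsContinuousFunctional Ψ)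
    (f h : ConvFn n) (hmin : ConvexOn ℝ Set.univ (⇑f.1 ⊓ ⇑h.1)) :
    Ψ ⟨f.1 ⊔ h.1, f.2.sup h.2⟩ + Ψ ⟨f.1 ⊓ h.1, by simpa using hmin⟩ = Ψ f + Ψ h := by
  set M : ConvFn n := ⟨f.1 ⊔ h.1, f.2.sup h.2⟩ with hMd
  set m : ConvFn n := ⟨f.1 ⊓ h.1, by simpa using hmin⟩ with hmd
  have hm : ∀ x, m.1 x = min (f.1 x) (h.1 x) := fun x => rfl
  have hM : ∀ x, M.1 x = max (f.1 x) (h.1 x) := fun x => rfl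
  apply Subtype.ext
  apply LinearMap.ext
  intro φ
  change (Ψ M).1 φ + (Ψ m).1 φ = (Ψ f).1 φ + (Ψ h).1 φ
  have hc : ∀ u : ConvFn n, (∀ x, m.1 x ≤ u.1 x) →
      Filter.Tendsto (fun δ : ℝ => (Ψ (trunc m u (3 * δ))).1 φ) (nhdsWithin 0 (Set.Ioi 0))
        (nhds ((Ψ u).1 φ)) := by
    intro u hu
    have h1 : Continuous fun δ : ℝ => (Ψ (trunc m u (3 * δ))).1 φ :=
      (hcont φ).comp ((trunc_cont m u).comp (continuous_const.mul continuous_id))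
    have h2 := (h1.tendsto 0).mono_left (nhdsWithin_le_nhds (s := Set.Ioi 0))
    simpa only [mul_zero, trunc_zero m u hu] using h2
  have L := (hc M fun x => by rw [hm, hM]; exact min_le_max).add (hc m fun x => le_rfl)
  have R := (hc f fun x => by rw [hm]; exact min_le_left _ _).add
    (hc h fun x => by rw [hm]; exact min_le_right _ _)
  refine tendsto_nhds_unique (L.congr' ?_) R
  filter_upwards [self_mem_nhdsWithin] with δ hδ
  exact key Ψ hloc f h m M hm hM φ δ hδ

end
end

section
/- For every Ψ ∈ P_dLV(ℝⁿ) there exist unique Z_k ∈ P_dLV(ℝⁿ), 0 ≤ k ≤ n+d, such that each Z_k is homogeneous of degree k (i.e. Z_k(tf) = t^k Z_k(f) for all t ≥ 0 and f ∈ Conv(ℝⁿ,ℝ)) and Ψ = Σ_{k=0}^{n+d} Z_k. Consequently Ψ(tf) = Σ_{k=0}^{n+d} t^k Z_k(f) for all f ∈ Conv(ℝⁿ,ℝ) and all t ≥ 0. -/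
open scoped CompactlySupported NNReal

noncomputable section

lemma convexOn_affine {n : ℕ} (s : ℝ) (v : Eucl n) :
    ConvexOn ℝ Set.univ (fun x : Eucl n => s + inner ℝ v x) := by
  refine ⟨convex_univ, fun x _ y _ a b _ _ hab => le_of_eq ?_⟩
  simp only [smul_eq_mul, inner_add_right, real_inner_smul_right]
  linear_combination s * hab.symm

/-- Add the affine function `ℓ(x) = s + ⟨v, x⟩` to a convex function. -/
def addAffine {n : ℕ} (f : ConvFn n) (s : ℝ) (v : Eucl n) : ConvFn n :=
  ⟨⟨fun x => f.1 x + (s + inner ℝ v x),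
    (map_continuous f.1).add (continuous_const.add (Continuous.inner continuous_const continuous_id))⟩,
    f.2.add (convexOn_affine s v)⟩

/-- `Ψ` is polynomial of degree at most `d`: for every `f` and `φ`, the map
`(s, v) ↦ Ψ(f + s + ⟨v, ·⟩)(φ)` is (the restriction of) a polynomial of degree at most `d`
on `ℝ × ℝⁿ`. -/
def IsPolynomialDeg {n : ℕ} (d : ℕ) (Ψ : ConvFn n → RadonMeasure n) : Prop :=
  ∀ (f : ConvFn n) (φ : C_c(Eucl n, ℂ)), ∃ P : MvPolynomial (Fin (n + 1)) ℂ,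
    P.totalDegree ≤ d ∧ ∀ (s : ℝ) (v : Eucl n),
      (Ψ (addAffine f s v)).1 φ = MvPolynomial.eval (Fin.cons (s : ℂ) fun i => (v i : ℂ)) P

/-- `P_dLV(ℝⁿ)`: continuous local functionals, polynomial of degree at most `d`. -/
def MemPdLV {n : ℕ} (d : ℕ) (Ψ : ConvFn n → RadonMeasure n) : Prop :=
  IsLocalFunctional Ψ ∧ IsContinuousFunctional Ψ ∧ IsPolynomialDeg d Ψ

/-- Multiply a convex function by a nonnegative scalar `t ≥ 0`. -/
def smulConv {n : ℕ} (t : ℝ≥0) (f : ConvFn n) : ConvFn n :=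
  ⟨(t : ℝ) • f.1, by exact f.2.smul t.2⟩

/-- `Ψ` is homogeneous of degree `k`: `Ψ(t f) = t^k Ψ(f)` for `t ≥ 0`. -/
def IsHomogeneousDeg {n : ℕ} (k : ℕ) (Ψ : ConvFn n → RadonMeasure n) : Prop :=
  ∀ (f : ConvFn n) (t : ℝ≥0), Ψ (smulConv t f) = ((t : ℝ) : ℂ) ^ k • Ψ f

namespace HomDec

section ring
lemma pow_mem_aux {A ι : Type*} [CommRing A] [DecidableEq ι] (X : A) (N : ι → A) (I : Ideal A)
    (hN : ∀ i, N i ∈ I) (s : Finset ι) : ∀ k : ℕ,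
    X ^ (s.card + k) ∈ Ideal.span {∏ i ∈ s, (X - N i)} ⊔ I ^ (k + 1) := by
  induction s using Finset.induction_on with
  | empty => intro k; simp
  | insert i s hi ih =>
    have key : ∀ k : ℕ, N i * X ^ (s.card + k) ∈
          Ideal.span {∏ i ∈ insert i s, (X - N i)} ⊔ I ^ (k + 1) →
        X ^ ((insert i s).card + k) ∈
          Ideal.span {∏ i ∈ insert i s, (X - N i)} ⊔ I ^ (k + 1) := by
      intro k h
      obtain ⟨a, ha, b, hb, hab⟩ := Submodule.mem_sup.1 (ih k)
      obtain ⟨c, rfl⟩ := Ideal.mem_span_singleton'.1 ha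
      have e : X ^ ((insert i s).card + k) = (c * ∏ i ∈ insert i s, (X - N i))
          + (X - N i) * b + N i * X ^ (s.card + k) := by
        rw [Finset.card_insert_of_notMem hi, Finset.prod_insert hi]
        have : X ^ (s.card + 1 + k) = X * X ^ (s.card + k) := by ring
        rw [this, ← hab]; ring
      rw [e]
      refine add_mem (add_mem ?_ ?_) h
      · exact Submodule.mem_sup_left (Ideal.mul_mem_left _ _ (Ideal.subset_span rfl))
      · exact Submodule.mem_sup_right (Ideal.mul_mem_left _ _ hb)
    intro k
    induction k with
    | zero =>
      apply key
      apply Submodule.mem_sup_right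
      simpa using Ideal.mul_mem_right _ _ (hN i)
    | succ k ihk =>
      apply key
      have : s.card + (k + 1) = (insert i s).card + k := by
        rw [Finset.card_insert_of_notMem hi]; ring
      rw [this]
      obtain ⟨a, ha, b, hb, hab⟩ := Submodule.mem_sup.1 ihk
      rw [← hab, mul_add]
      refine add_mem ?_ ?_
      · exact Submodule.mem_sup_left (Ideal.mul_mem_left _ _ ha)
      · apply Submodule.mem_sup_right
        rw [pow_succ, mul_comm (N i)]
        exact Ideal.mul_mem_mul hb (hN i)
end ring

section shift
variable {M : Type*} [AddCommMonoid M]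

/-- shift operators -/
def shiftHom (M : Type*) [AddCommMonoid M] : Multiplicative M →* Module.End ℂ (M → ℂ) where
  toFun h := { toFun := fun F g => F (g + h.toAdd), map_add' := fun _ _ => rfl,
               map_smul' := fun _ _ => rfl }
  map_one' := by ext F g; simp
  map_mul' a b := by
    apply LinearMap.ext; intro F; funext g
    simp [Module.End.mul_apply, add_assoc]

/-- action of the semigroup algebra on functions -/
def act (M : Type*) [AddCommMonoid M] : AddMonoidAlgebra ℂ M →ₐ[ℂ] Module.End ℂ (M → ℂ) :=
  AddMonoidAlgebra.lift ℂ _ M (shiftHom M)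

/-- exponential -/
def ex (h : M) : AddMonoidAlgebra ℂ M := AddMonoidAlgebra.single h 1

lemma act_ex (h : M) (F : M → ℂ) (g : M) : act M (ex h) F g = F (g + h) := by
  simp [act, ex, shiftHom]

lemma act_mul (a b : AddMonoidAlgebra ℂ M) (F : M → ℂ) : act M (a * b) F = act M a (act M b F) := by
  rw [map_mul]; rfl

lemma act_ex_sub (h k : M) (F : M → ℂ) (g : M) :
    act M (ex h - ex k) F g = F (g + h) - F (g + k) := by
  rw [map_sub, LinearMap.sub_apply, Pi.sub_apply, act_ex, act_ex]

lemma act_ex_sub_one (h : M) (F : M → ℂ) : act M (ex h - 1) F = fwdDiff h F := by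
  ext g
  rw [map_sub, LinearMap.sub_apply, Pi.sub_apply, act_ex, map_one]; rfl

lemma act_pow (h : M) (F : M → ℂ) (k : ℕ) : act M ((ex h - 1) ^ k) F = (fwdDiff h)^[k] F := by
  induction k generalizing F with
  | zero => simp
  | succ k ih => rw [pow_succ, act_mul, ih, act_ex_sub_one]; rfl

/-- annihilator -/
def ann (F : M → ℂ) : Ideal (AddMonoidAlgebra ℂ M) where
  carrier := {a | act M a F = 0}
  add_mem' := by intro a b ha hb; simp only [Set.mem_ofPred_eq] at *; simp [ha, hb]
  zero_mem' := by simp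
  smul_mem' := by
    intro c a ha; simp only [Set.mem_ofPred_eq, smul_eq_mul] at *
    rw [act_mul, ha, map_zero]

lemma mem_ann {F : M → ℂ} {a} : a ∈ ann F ↔ act M a F = 0 := Iff.rfl

/-- a filtration lowering degree -/
lemma pow_le_ann (S : Set M) (V : ℕ → Set (M → ℂ))
    (h0 : ∀ F ∈ V 0, ∀ l ∈ S, fwdDiff l F = 0)
    (h1 : ∀ k, ∀ F ∈ V (k + 1), ∀ l ∈ S, fwdDiff l F ∈ V k) (k : ℕ) :
    ∀ F ∈ V k, Ideal.span ((fun l => ex l - 1) '' S) ^ (k + 1) ≤ ann F := by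
  induction k with
  | zero =>
    intro F hF
    rw [zero_add, pow_one, Ideal.span_le]
    rintro _ ⟨l, hl, rfl⟩
    rw [SetLike.mem_coe, mem_ann, act_ex_sub_one, h0 F hF l hl]
  | succ k ih =>
    intro F hF
    rw [pow_succ, Ideal.mul_le]
    intro a ha b hb
    induction hb using Submodule.span_induction with
    | mem x hx =>
      obtain ⟨l, hl, rfl⟩ := hx
      rw [mem_ann, act_mul, act_ex_sub_one]
      exact ih _ (h1 k F hF l hl) ha
    | zero => simp
    | add x y _ _ hx hy => rw [mul_add]; exact add_mem hx hy
    | smul c x _ hx => rw [smul_eq_mul, mul_left_comm]; exact Ideal.mul_mem_left _ _ hx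

lemma iter_zero {ι : Type*} (S : Set M) (V : ℕ → Set (M → ℂ))
    (h0 : ∀ F ∈ V 0, ∀ l ∈ S, fwdDiff l F = 0)
    (h1 : ∀ k, ∀ F ∈ V (k + 1), ∀ l ∈ S, fwdDiff l F ∈ V k) (d : ℕ) (F : M → ℂ) (hF : F ∈ V d)
    (s : Finset ι) (f : M) (l : ι → M) (hl : ∀ i, l i ∈ S)
    (hs : act M (∏ i ∈ s, (ex f - ex (l i))) F = 0) (n : ℕ) (hn : s.card ≤ n + 1) :
    (fwdDiff f)^[n + d + 1] F = 0 := by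
  classical
  have := pow_mem_aux (ex f - 1) (fun i => ex (l i) - 1) (Ideal.span ((fun l => ex l - 1) '' S))
    (fun i => Ideal.subset_span ⟨_, hl i, rfl⟩) s d
  have h2 : (ex f - 1) ^ (s.card + d) ∈ ann F := by
    refine (sup_le ?_ (pow_le_ann S V h0 h1 d F hF)) this
    rw [Ideal.span_le, Set.singleton_subset_iff, SetLike.mem_coe, mem_ann]
    simpa using hs
  have h3 : (ex f - 1) ^ (n + d + 1) ∈ ann F := Ideal.pow_mem_of_pow_mem _ h2 (by omega)
  rw [← act_pow]; exact h3

end shift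

section mv
open MvPolynomial
variable {σ : Type*}

/-- difference of a polynomial -/
def mvD (a : σ → ℂ) : MvPolynomial σ ℂ →ₗ[ℂ] MvPolynomial σ ℂ :=
  (aeval (fun i => X i + C (a i)) : MvPolynomial σ ℂ →ₐ[ℂ] MvPolynomial σ ℂ).toLinearMap
    - LinearMap.id

lemma mvD_apply (a : σ → ℂ) (P : MvPolynomial σ ℂ) :
    mvD a P = aeval (fun i => X i + C (a i)) P - P := rfl

lemma eval_mvD (a : σ → ℂ) (P : MvPolynomial σ ℂ) (x : σ → ℂ) :
    eval x (mvD a P) = eval (x + a) P - eval x P := by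
  rw [mvD_apply, map_sub]
  congr 1
  have : (eval x).comp (aeval (fun i => X i + C (a i)) :
      MvPolynomial σ ℂ →ₐ[ℂ] MvPolynomial σ ℂ).toRingHom = eval (x + a) := by
    apply MvPolynomial.ringHom_ext
    · intro r; simp
    · intro i; simp
  exact congrArg (fun f => f P) this

lemma mvD_monomial (a : σ → ℂ) (m : σ →₀ ℕ) (c : ℂ) :
    mvD a (monomial m c) = 0 ∨
      (mvD a (monomial m c)).totalDegree + 1 ≤ (monomial m c).totalDegree := by
  refine MvPolynomial.induction_on_monomial
    (motive := fun p => mvD a p = 0 ∨ (mvD a p).totalDegree + 1 ≤ p.totalDegree) ?_ ?_ m c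
  · intro c; left; simp [mvD_apply]
  · intro p i hp
    by_cases hp0 : p = 0
    · left; simp [hp0]
    right
    have e : mvD a (p * X i) = mvD a p * (X i + C (a i)) + p * C (a i) := by
      simp only [mvD_apply, map_mul, aeval_X]; ring
    rw [totalDegree_mul_of_isDomain hp0 (X_ne_zero i), totalDegree_X, e]
    apply Nat.succ_le_succ
    refine (totalDegree_add _ _).trans (max_le ?_ ?_)
    · rcases hp with h | h
      · simp [h]
      · refine (totalDegree_mul _ _).trans ?_
        refine le_trans ?_ h
        gcongr
        refine (totalDegree_add _ _).trans (max_le ?_ ?_) <;> simp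
    · refine (totalDegree_mul _ _).trans ?_
      simp

lemma mvD_totalDegree (a : σ → ℂ) (P : MvPolynomial σ ℂ) (k : ℕ) (h : P.totalDegree ≤ k + 1) :
    (mvD a P).totalDegree ≤ k := by
  conv_lhs => rw [P.as_sum, map_sum]
  apply totalDegree_finsetSum_le
  intro m hm
  rcases mvD_monomial a m (coeff m P) with h1 | h1
  · simp [h1]
  · have : (monomial m (coeff m P)).totalDegree ≤ P.totalDegree :=
      (totalDegree_monomial_le _ _).trans (le_totalDegree hm)
    omega

lemma mvD_zero (a : σ → ℂ) (P : MvPolynomial σ ℂ) (h : P.totalDegree ≤ 0) :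
    mvD a P = 0 := by
  rw [Nat.le_zero, totalDegree_eq_zero_iff_eq_C] at h
  rw [h, mvD_apply]; simp

/-- rescaling a polynomial -/
lemma exists_rescale (c : ℂ) (P : MvPolynomial σ ℂ) (d : ℕ) (h : P.totalDegree ≤ d) :
    ∃ Q : MvPolynomial σ ℂ, Q.totalDegree ≤ d ∧ ∀ x, eval x Q = eval (c • x) P := by
  refine ⟨∑ m ∈ P.support, monomial m (coeff m P * c ^ (m.sum fun _ e => e)), ?_, ?_⟩
  · apply totalDegree_finsetSum_le
    intro m hm
    exact ((totalDegree_monomial_le _ _).trans (le_totalDegree hm)).trans h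
  · intro x
    conv_rhs => rw [P.as_sum]
    rw [map_sum, map_sum]
    apply Finset.sum_congr rfl
    intro m _
    rw [eval_monomial, eval_monomial, mul_assoc]
    congr 1
    simp only [Finsupp.prod, Finsupp.sum, Pi.smul_apply, smul_eq_mul, mul_pow,
      Finset.prod_mul_distrib, Finset.prod_pow_eq_pow_sum]
end mv

section conv
variable {n : ℕ}

/-- the convex functions as an additive monoid -/
def convSub (n : ℕ) : AddSubmonoid C(Eucl n, ℝ) where
  carrier := {f | ConvexOn ℝ Set.univ ⇑f}
  add_mem' := by intro a b ha hb; exact ha.add hb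
  zero_mem' := convexOn_const 0 convex_univ

instance : AddCommMonoid (ConvFn n) := inferInstanceAs (AddCommMonoid (convSub n))
instance : ContinuousAdd (ConvFn n) := inferInstanceAs (ContinuousAdd (convSub n))

lemma add_apply (f g : ConvFn n) (x : Eucl n) : (f + g).1 x = f.1 x + g.1 x := rfl
lemma zero_apply (x : Eucl n) : (0 : ConvFn n).1 x = 0 := rfl
lemma nsmul_apply (k : ℕ) (f : ConvFn n) (x : Eucl n) : (k • f).1 x = k * f.1 x := by
  induction k with
  | zero => simp [zero_apply]
  | succ k ih => rw [succ_nsmul, add_apply, ih]; push_cast; ring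

lemma smul_apply (t : ℝ≥0) (f : ConvFn n) (x : Eucl n) : (smulConv t f).1 x = t * f.1 x := rfl

lemma conv_ext {f g : ConvFn n} (h : ∀ x, f.1 x = g.1 x) : f = g :=
  Subtype.ext (ContinuousMap.ext h)

/-- affine functions -/
def aff (s : ℝ) (v : Eucl n) : ConvFn n := addAffine 0 s v

lemma aff_apply (s : ℝ) (v x : Eucl n) : (aff s v).1 x = s + inner ℝ v x := zero_add _

lemma addAffine_eq (f : ConvFn n) (s : ℝ) (v : Eucl n) : addAffine f s v = f + aff s v := by
  apply conv_ext; intro x; rw [add_apply, aff_apply]; rfl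

/-- functions of polynomial degree at most `k` -/
def VV (n k : ℕ) : Set (ConvFn n → ℂ) :=
  {F | ∀ g, ∃ P : MvPolynomial (Fin (n + 1)) ℂ, P.totalDegree ≤ k ∧ ∀ (s : ℝ) (v : Eucl n),
      F (g + aff s v) = MvPolynomial.eval (Fin.cons (s : ℂ) fun i => (v i : ℂ)) P}

lemma aff_add (s t : ℝ) (v w : Eucl n) : aff s v + aff t w = aff (s + t) (v + w) := by
  apply conv_ext; intro x; simp only [add_apply, aff_apply, inner_add_left]; ring

lemma cons_add (s t : ℝ) (v w : Eucl n) :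
    (Fin.cons ((s + t : ℝ) : ℂ) (fun i => ((v + w) i : ℂ)) : Fin (n + 1) → ℂ) =
     (Fin.cons (s : ℂ) (fun i => (v i : ℂ)) : Fin (n + 1) → ℂ) + Fin.cons (t : ℂ) (fun i => (w i : ℂ)) := by
  funext i
  refine Fin.cases ?_ (fun j => ?_) i <;> simp

lemma cons_smul (c s : ℝ) (v : Eucl n) :
    (Fin.cons ((c * s : ℝ) : ℂ) (fun i => ((c • v) i : ℂ)) : Fin (n + 1) → ℂ) =
     (c : ℂ) • (Fin.cons (s : ℂ) (fun i => (v i : ℂ)) : Fin (n + 1) → ℂ) := by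
  funext i
  refine Fin.cases ?_ (fun j => ?_) i <;> simp

/-- set of affine functions -/
def affSet (n : ℕ) : Set (ConvFn n) := {l | ∃ s v, l = aff s v}

lemma VV_eval {F : ConvFn n → ℂ} (g : ConvFn n) (t : ℝ) (w : Eucl n)
    (P : MvPolynomial (Fin (n + 1)) ℂ)
    (h : ∀ (s : ℝ) (v : Eucl n),
      F (g + aff s v) = MvPolynomial.eval (Fin.cons (s : ℂ) fun i => (v i : ℂ)) P)
    (s : ℝ) (v : Eucl n) : fwdDiff (aff t w) F (g + aff s v) =
      MvPolynomial.eval (Fin.cons (s : ℂ) fun i => (v i : ℂ))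
        (mvD (Fin.cons (t : ℂ) fun i => (w i : ℂ)) P) := by
  rw [eval_mvD, ← cons_add, ← h, ← h, fwdDiff, add_assoc, aff_add]

lemma VV_zero (F) (hF : F ∈ VV n 0) (l) (hl : l ∈ affSet n) : fwdDiff l F = 0 := by
  obtain ⟨t, w, rfl⟩ := hl
  funext g
  obtain ⟨P, hP, h⟩ := hF g
  have := VV_eval g t w P h 0 0
  rw [mvD_zero _ _ hP, map_zero] at this
  have e : g + aff 0 0 = g := by apply conv_ext; intro x; simp [add_apply, aff_apply]
  rw [e] at this; exact this

lemma VV_succ (k : ℕ) (F) (hF : F ∈ VV n (k + 1)) (l) (hl : l ∈ affSet n) : fwdDiff l F ∈ VV n k := by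
  obtain ⟨t, w, rfl⟩ := hl
  intro g
  obtain ⟨P, hP, h⟩ := hF g
  exact ⟨_, mvD_totalDegree _ P k hP, VV_eval g t w P h⟩

lemma poly_mem {d : ℕ} {Ψ : ConvFn n → RadonMeasure n} (h : IsPolynomialDeg d Ψ)
    (φ : C_c(Eucl n, ℂ)) : (fun f => (Ψ f).1 φ) ∈ VV n d := by
  intro g
  obtain ⟨P, hP, h⟩ := h g φ
  exact ⟨P, hP, fun s v => by rw [← addAffine_eq]; exact h s v⟩

end conv

section loc
variable {n : ℕ}

/-- multiply a test function by a continuous function -/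
def mulC (ρ : C(Eucl n, ℝ)) (φ : C_c(Eucl n, ℂ)) : C_c(Eucl n, ℂ) :=
  ⟨⟨fun x => (ρ x : ℂ) * φ x, by fun_prop⟩, φ.hasCompactSupport'.mul_left⟩

lemma mulC_apply (ρ : C(Eucl n, ℝ)) (φ : C_c(Eucl n, ℂ)) (x : Eucl n) :
    mulC ρ φ x = (ρ x : ℂ) * φ x := rfl

lemma local_zero (L : C_c(Eucl n, ℂ) →ₗ[ℂ] ℂ)
    (h : ∀ x, ∃ U : Set (Eucl n), IsOpen U ∧ x ∈ U ∧ ∀ φ : C_c(Eucl n, ℂ), tsupport ⇑φ ⊆ U → L φ = 0) :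
    L = 0 := by
  choose U hUo hxU hU using h
  obtain ⟨ρ, hρ⟩ := PartitionOfUnity.exists_isSubordinate (X := Eucl n) isClosed_univ U hUo
    (fun x _ => Set.mem_iUnion.2 ⟨x, hxU x⟩)
  ext φ
  have hfin := ρ.locallyFinite.finite_nonempty_inter_compact φ.hasCompactSupport'
  have e : φ = ∑ i ∈ hfin.toFinset, mulC (ρ i) φ := by
    ext x
    rw [CompactlySupportedContinuousMap.sum_apply]
    simp only [mulC_apply]
    rw [← Finset.sum_mul]
    by_cases hx : φ x = 0
    · simp [hx]
    · have h1 := ρ.sum_eq_one (Set.mem_univ x)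
      rw [finsum_eq_sum_of_support_subset (s := hfin.toFinset)] at h1
      · rw [← Complex.ofReal_sum, h1]; simp
      · intro i hi
        rw [Finset.mem_coe, Set.Finite.mem_toFinset]
        exact ⟨x, hi, subset_tsupport _ hx⟩
  rw [e, map_sum]
  apply Finset.sum_eq_zero
  intro i _
  apply hU i
  refine subset_trans ?_ (hρ i)
  apply closure_mono
  intro x hx h0
  apply hx
  change (ρ i x : ℂ) * φ x = 0
  have : ρ i x = 0 := h0
  rw [this]; simp

/-- max of f - ε and l -/
def maxS (f l : ConvFn n) (ε : ℝ) : ConvFn n :=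
  ⟨⟨fun x => max (f.1 x - ε) (l.1 x), by fun_prop⟩,
    (f.2.sub (concaveOn_const ε convex_univ)).sup l.2⟩

lemma maxS_apply (f l : ConvFn n) (ε : ℝ) (x) : (maxS f l ε).1 x = max (f.1 x - ε) (l.1 x) := rfl

lemma continuous_maxS (f l : ConvFn n) : Continuous (maxS f l) := by
  apply Continuous.subtype_mk
  apply ContinuousMap.continuous_of_continuous_uncurry
  change Continuous fun p : ℝ × Eucl n => max (f.1 p.2 - p.1) (l.1 p.2)
  fun_prop

/-- `Ψ` as linear map in the test function -/
def evalL (Ψ : ConvFn n → RadonMeasure n) : C_c(Eucl n, ℂ) →ₗ[ℂ] (ConvFn n → ℂ) :=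
  LinearMap.pi (fun f => (Ψ f).1)

lemma evalL_apply (Ψ : ConvFn n → RadonMeasure n) (φ f) : evalL Ψ φ f = (Ψ f).1 φ := rfl

lemma act_prod_continuous {ι : Type*} (s : Finset ι) (F : ConvFn n → ℂ) (hF : Continuous F)
    (h : ι → ℝ → ConvFn n) (hh : ∀ i, Continuous (h i)) (l : ι → ConvFn n) :
    Continuous fun p : ℝ × ConvFn n =>
      act (ConvFn n) (∏ i ∈ s, (ex (h i p.1) - ex (l i))) F p.2 := by
  classical
  induction s using Finset.induction_on with
  | empty =>
    have e : (fun p : ℝ × ConvFn n =>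
      act (ConvFn n) (∏ i ∈ (∅ : Finset ι), (ex (h i p.1) - ex (l i))) F p.2) = fun p => F p.2 := by
      funext p; rw [Finset.prod_empty, map_one]; rfl
    rw [e]; exact hF.comp continuous_snd
  | insert j s hj ih =>
    have e : (fun p : ℝ × ConvFn n =>
      act (ConvFn n) (∏ i ∈ insert j s, (ex (h i p.1) - ex (l i))) F p.2) = fun p =>
      act (ConvFn n) (∏ i ∈ s, (ex (h i p.1) - ex (l i))) F (p.2 + h j p.1) -
      act (ConvFn n) (∏ i ∈ s, (ex (h i p.1) - ex (l i))) F (p.2 + l j) := by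
      funext p
      rw [Finset.prod_insert hj, act_mul, act_ex_sub]
    rw [e]
    have c1 : Continuous fun p : ℝ × ConvFn n => (p.1, p.2 + h j p.1) :=
      continuous_fst.prodMk (continuous_snd.add ((hh j).comp continuous_fst))
    have c2 : Continuous fun p : ℝ × ConvFn n => (p.1, p.2 + l j) :=
      continuous_fst.prodMk (continuous_snd.add continuous_const)
    generalize hQ : (fun p : ℝ × ConvFn n =>
      act (ConvFn n) (∏ i ∈ s, (ex (h i p.1) - ex (l i))) F p.2) = Q at ih
    have hQ' : ∀ (a : ℝ) (b : ConvFn n),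
        act (ConvFn n) (∏ i ∈ s, (ex (h i a) - ex (l i))) F b = Q (a, b) := by
      intro a b; rw [← hQ]
    simp only [hQ']
    exact (ih.comp c1).sub (ih.comp c2)

/-- `f` is the max of `l i`, `i ∈ s`. -/
def IsMx {ι : Type*} (s : Finset ι) (l : ι → ConvFn n) (f : ConvFn n) : Prop :=
  (∀ i ∈ s, ∀ x, (l i).1 x ≤ f.1 x) ∧ ∀ x, ∃ i ∈ s, f.1 x = (l i).1 x

lemma cover_identity {Ψ : ConvFn n → RadonMeasure n} (hl : IsLocalFunctional Ψ)
    (hc : IsContinuousFunctional Ψ) {ι : Type*} (s : Finset ι) (l : ι → ConvFn n) (f : ConvFn n)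
    (hf : IsMx s l f) (φ : C_c(Eucl n, ℂ)) :
    act (ConvFn n) (∏ i ∈ s, (ex f - ex (l i))) (evalL Ψ φ) = 0 := by
  classical
  have h1 : ∀ ε > 0, ∀ g, act (ConvFn n) (∏ i ∈ s, (ex (maxS f (l i) ε) - ex (l i))) (evalL Ψ φ) g = 0 := by
    intro ε hε g
    set a := (∏ i ∈ s, (ex (maxS f (l i) ε) - ex (l i)))
    let L : C_c(Eucl n, ℂ) →ₗ[ℂ] ℂ := LinearMap.proj g ∘ₗ act (ConvFn n) a ∘ₗ evalL Ψ
    suffices L = 0 from congrArg (fun L => L φ) this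
    apply local_zero
    intro x
    obtain ⟨i, hi, hx⟩ := hf.2 x
    refine ⟨{y | f.1 y - ε < (l i).1 y}, isOpen_lt (by fun_prop) (by fun_prop), ?_, ?_⟩
    · simp [hx, hε]
    · intro φ hφ
      change act (ConvFn n) a (evalL Ψ φ) g = 0
      have : act (ConvFn n) (ex (maxS f (l i) ε) - ex (l i)) (evalL Ψ φ) = 0 := by
        funext g
        rw [act_ex_sub, evalL_apply, evalL_apply, Pi.zero_apply, sub_eq_zero]
        refine hl _ _ _ (isOpen_lt (by fun_prop) (by fun_prop)) ?_ φ hφ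
        intro y hy
        rw [add_apply, add_apply, maxS_apply, max_eq_right (le_of_lt hy)]
      have e : a = (∏ j ∈ s.erase i, (ex (maxS f (l j) ε) - ex (l j))) *
          (ex (maxS f (l i) ε) - ex (l i)) := (Finset.prod_erase_mul _ _ hi).symm
      rw [e, act_mul, this, map_zero]; rfl
  have h0 : ∀ i ∈ s, maxS f (l i) 0 = f := by
    intro i hi
    apply conv_ext; intro x
    rw [maxS_apply, sub_zero, max_eq_left (hf.1 i hi x)]
  have e : ∏ i ∈ s, (ex f - ex (l i)) = ∏ i ∈ s, (ex (maxS f (l i) 0) - ex (l i)) :=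
    Finset.prod_congr rfl (fun i hi => by rw [h0 i hi])
  funext g
  rw [e]
  have hcont := (act_prod_continuous s (evalL Ψ φ) (hc φ) (fun i => maxS f (l i))
    (fun i => continuous_maxS f (l i)) l).comp (Continuous.prodMk_left g)
  have t1 := (hcont.tendsto 0).mono_left (nhdsWithin_le_nhds (s := Set.Ioi 0))
  refine tendsto_nhds_unique t1 ?_
  refine tendsto_const_nhds.congr' ?_
  filter_upwards [self_mem_nhdsWithin] with ε hε
  exact (h1 ε hε g).symm

lemma iter_zero' {d : ℕ} {Ψ : ConvFn n → RadonMeasure n} (hΨ : MemPdLV d Ψ)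
    {ι : Type*} (s : Finset ι) (hs : s.card ≤ n + 1) (l : ι → ConvFn n) (hl : ∀ i, l i ∈ affSet n)
    (f : ConvFn n) (hf : IsMx s l f) (φ : C_c(Eucl n, ℂ)) :
    (fwdDiff f)^[n + d + 1] (evalL Ψ φ) = 0 :=
  iter_zero (affSet n) (VV n) VV_zero VV_succ d _ (poly_mem hΨ.2.2 φ) s f l hl
    (cover_identity hΨ.1 hΨ.2.1 s l f hf φ) n hs

end loc

section frechet
open Polynomial

lemma nat_poly {M : Type*} [AddCommMonoid M] (F : M → ℂ) (h : M) (N : ℕ)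
    (hF : (fwdDiff h)^[N + 1] F = 0) :
    ∃ p : ℂ[X], p.degree < (N + 1 : ℕ) ∧ ∀ k : ℕ, F (k • h) = p.eval (k : ℂ) := by
  have hz : ∀ j, N + 1 ≤ j → (fwdDiff h)^[j] F = 0 := by
    intro j hj
    obtain ⟨i, rfl⟩ := Nat.exists_eq_add_of_le' hj
    rw [Function.iterate_add_apply, hF]
    clear hj
    induction i with
    | zero => rfl
    | succ i ih =>
      rw [Function.iterate_succ_apply', ih]; funext x; simp [fwdDiff]
  refine ⟨∑ j ∈ Finset.range (N + 1), C ((fwdDiff h)^[j] F 0 / (j.factorial : ℂ)) * descPochhammer ℂ j, ?_, ?_⟩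
  · refine lt_of_le_of_lt (degree_sum_le _ _) ?_
    rw [Finset.sup_lt_iff (by exact_mod_cast WithBot.bot_lt_coe _)]
    intro j hj
    rw [degree_lt_iff_coeff_zero]; intro m hm
    rw [coeff_C_mul, coeff_eq_zero_of_natDegree_lt, mul_zero]
    rw [descPochhammer_natDegree]
    have := Finset.mem_range.1 hj; omega
  · intro k
    have := shift_eq_sum_fwdDiff_iter h F k 0
    rw [zero_add] at this
    rw [this, eval_finsetSum]
    have e1 : ∑ j ∈ Finset.range (k + 1), k.choose j • (fwdDiff h)^[j] F 0 =
        ∑ j ∈ Finset.range (N + 1 + (k + 1)), k.choose j • (fwdDiff h)^[j] F 0 := by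
      apply Finset.sum_subset (Finset.range_mono (by omega))
      intro j _ hj
      rw [Nat.choose_eq_zero_of_lt (by simpa using hj), zero_smul]
    have e2 : ∑ j ∈ Finset.range (N + 1), k.choose j • (fwdDiff h)^[j] F 0 =
        ∑ j ∈ Finset.range (N + 1 + (k + 1)), k.choose j • (fwdDiff h)^[j] F 0 := by
      apply Finset.sum_subset (Finset.range_mono (by omega))
      intro j _ hj
      rw [hz j (by simpa using hj)]; simp
    rw [e1, ← e2]
    apply Finset.sum_congr rfl
    intro j _
    rw [eval_mul, eval_C, descPochhammer_eval_eq_descFactorial, Nat.descFactorial_eq_factorial_mul_choose]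
    have : (j.factorial : ℂ) ≠ 0 := by exact_mod_cast j.factorial_ne_zero
    push_cast
    rw [nsmul_eq_mul]
    field_simp

/-- polynomial on all positive scalings of naturals, continuous => polynomial -/
lemma real_poly (G : ℝ≥0 → ℂ) (hG : Continuous G) (N : ℕ)
    (h : ∀ u : ℝ≥0, ∃ p : ℂ[X], p.degree < (N + 1 : ℕ) ∧ ∀ k : ℕ, G (k * u) = p.eval (k : ℂ)) :
    ∃ p : ℂ[X], p.degree < (N + 1 : ℕ) ∧ ∀ t : ℝ≥0, G t = p.eval ((t : ℝ) : ℂ) := by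
  obtain ⟨p, hp, hpk⟩ := h 1
  refine ⟨p, hp, ?_⟩
  have hq : ∀ (a q : ℕ), q ≠ 0 → G (a / q) = p.eval ((a : ℂ) / q) := by
    intro a q hq
    obtain ⟨r, hr, hrk⟩ := h (1 / q)
    have hq1 : (q : ℝ≥0) ≠ 0 := by exact_mod_cast hq
    have hq2 : (q : ℂ) ≠ 0 := by exact_mod_cast hq
    have : p = r.comp (C (q : ℂ) * X) := by
      apply Polynomial.eq_of_infinite_eval_eq
      refine Set.Infinite.mono (s := Set.range (fun k : ℕ => (k : ℂ))) ?_ 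
        (Set.infinite_range_of_injective Nat.cast_injective)
      rintro _ ⟨k, rfl⟩
      change p.eval (k : ℂ) = _
      rw [← hpk, eval_comp]
      have := hrk (q * k)
      push_cast at this
      simp only [eval_mul, eval_C, eval_X]
      rw [← this]
      congr 1
      field_simp
    rw [this, eval_comp]
    simp only [eval_mul, eval_C, eval_X]
    rw [mul_div_cancel₀ _ hq2, ← hrk]
    congr 1
    field_simp
  intro t
  have ht : Filter.Tendsto (fun k : ℕ => ((⌊(t : ℝ) * (k : ℝ)⌋₊ : ℝ≥0) / (k : ℝ≥0))) Filter.atTop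
      (nhds t) := by
    rw [← NNReal.tendsto_coe]
    have := (tendsto_nat_floor_mul_div_atTop (R := ℝ) t.2).comp tendsto_natCast_atTop_atTop
    simpa [Function.comp_def] using this
  have t1 := (hG.tendsto t).comp ht
  have hc : Continuous fun t : ℝ≥0 => p.eval ((t : ℝ) : ℂ) :=
    p.continuous.comp (Complex.continuous_ofReal.comp NNReal.continuous_coe)
  have t2 := (hc.tendsto t).comp ht
  refine tendsto_nhds_unique t1 (t2.congr' ?_)
  filter_upwards [Filter.eventually_ne_atTop 0] with k hk
  simp only [Function.comp_apply]
  rw [hq _ k hk]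
  simp

end frechet

section gen
variable {n : ℕ}

/-- exceptional subspace -/
def excW {ι : Type*} (v : ι → Eucl n) (S : Finset ι) : Submodule ℝ (ι → ℝ) where
  carrier := {c | ∃ (x : Eucl n) (z : ℝ), ∀ i ∈ S, c i + inner ℝ (v i) x = z}
  add_mem' := by
    rintro a b ⟨x, z, h⟩ ⟨y, w, h'⟩
    refine ⟨x + y, z + w, fun i hi => ?_⟩
    rw [← h i hi, ← h' i hi, inner_add_right, Pi.add_apply]; ring
  zero_mem' := ⟨0, 0, fun i _ => by simp⟩
  smul_mem' := by
    rintro r a ⟨x, z, h⟩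
    refine ⟨r • x, r * z, fun i hi => ?_⟩
    rw [← h i hi, inner_smul_right, Pi.smul_apply, smul_eq_mul]; ring

lemma excW_top {ι : Type*} [DecidableEq ι] (v : ι → Eucl n) (S : Finset ι) (h : excW v S = ⊤) :
    S.card ≤ n + 1 := by
  let A : (Eucl n × ℝ) →ₗ[ℝ] (S → ℝ) :=
    LinearMap.pi fun i => LinearMap.snd ℝ _ _ - (innerₗ (Eucl n) (v i)) ∘ₗ LinearMap.fst ℝ _ _
  have hA : Function.Surjective A := by
    intro c
    let c' : ι → ℝ := fun i => if hi : i ∈ S then c ⟨i, hi⟩ else 0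
    have : c' ∈ excW v S := by rw [h]; trivial
    obtain ⟨x, z, hx⟩ := this
    refine ⟨(x, z), ?_⟩
    funext i
    have := hx i i.2
    simp only [c', i.2, dite_true] at this
    simp only [A, LinearMap.pi_apply, LinearMap.sub_apply, LinearMap.snd_apply, LinearMap.comp_apply,
      LinearMap.fst_apply, innerₗ_apply_apply]
    linarith
  have := LinearMap.finrank_le_finrank_of_surjective hA
  simpa using this

lemma exists_generic {ι : Type*} [Fintype ι] (c : ι → ℝ) (v : ι → Eucl n) (ε : ℝ) (hε : 0 < ε) :
    ∃ c' : ι → ℝ, (∀ i, |c' i - c i| < ε) ∧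
      ∀ S : Finset ι, ∀ (x : Eucl n) (z : ℝ), (∀ i ∈ S, c' i + inner ℝ (v i) x = z) →
        S.card ≤ n + 1 := by
  classical
  let T := {S : Finset ι // n + 1 < S.card}
  have h1 : (⋃ S : T, (excW v S.1 : Set (ι → ℝ))) ≠ Set.univ := by
    intro h
    obtain ⟨S, hS⟩ := Subspace.exists_eq_top_of_iUnion_eq_univ h
    have := excW_top v S.1 hS
    have := S.2
    omega
  obtain ⟨e, he⟩ := (Set.ne_univ_iff_exists_notMem _).1 h1
  have h2 : ∀ S : T, {δ : ℝ | c + δ • e ∈ excW v S.1}.Subsingleton := by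
    intro S a ha b hb
    by_contra hab
    apply he
    refine Set.mem_iUnion.2 ⟨S, ?_⟩
    have h3 : (c + a • e) - (c + b • e) ∈ excW v S.1 := sub_mem ha hb
    have h4 : (c + a • e) - (c + b • e) = (a - b) • e := by rw [sub_smul]; abel
    rw [h4] at h3
    exact (Submodule.smul_mem_iff _ (sub_ne_zero.2 hab)).1 h3
  have h3 : (⋃ S : T, {δ : ℝ | c + δ • e ∈ excW v S.1}).Finite :=
    Set.finite_iUnion fun S => (h2 S).finite
  have hs : 0 ≤ ∑ i, |e i| := Finset.sum_nonneg fun i _ => abs_nonneg _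
  have hη : 0 < ε / (1 + ∑ i, |e i|) := by positivity
  obtain ⟨δ, hδ, hδ'⟩ := (Set.Ioo_infinite hη).exists_notMem_finite h3
  refine ⟨c + δ • e, ?_, ?_⟩
  · intro i
    have h5 : |e i| ≤ ∑ i, |e i| := Finset.single_le_sum (f := fun i => |e i|) (fun i _ => abs_nonneg _) (Finset.mem_univ i)
    have h6 : δ * (1 + ∑ i, |e i|) < ε := (lt_div_iff₀ (by positivity)).1 hδ.2
    simp only [Pi.add_apply, Pi.smul_apply, smul_eq_mul, add_sub_cancel_left, abs_mul, abs_of_pos hδ.1]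
    have := hδ.1
    nlinarith
  · intro S x z h
    by_contra hS
    apply hδ'
    exact Set.mem_iUnion.2 ⟨⟨S, by omega⟩, x, z, h⟩

lemma exists_mx {ι : Type*} (s : Finset ι) (hs : s.Nonempty) (l : ι → ConvFn n) :
    ∃ f, IsMx s l f := by
  classical
  induction hs using Finset.Nonempty.cons_induction with
  | singleton a => exact ⟨l a, by simp [IsMx]⟩
  | cons a s ha hs ih =>
    obtain ⟨f, hf⟩ := ih
    refine ⟨maxS f (l a) 0, ?_, ?_⟩
    · intro i hi x
      rw [maxS_apply, sub_zero]
      rcases Finset.mem_cons.1 hi with rfl | hi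
      · exact le_max_right _ _
      · exact (hf.1 i hi x).trans (le_max_left _ _)
    · intro x
      rw [maxS_apply, sub_zero]
      rcases max_choice (f.1 x) ((l a).1 x) with h | h
      · obtain ⟨i, hi, h'⟩ := hf.2 x
        exact ⟨i, Finset.mem_cons_of_mem hi, by rw [h, h']⟩
      · exact ⟨a, Finset.mem_cons_self _ _, h⟩

/-- functions which are locally maxima of `n+1` affine functions -/
def Good (f : ConvFn n) : Prop :=
  ∀ x, ∃ U : Set (Eucl n), IsOpen U ∧ x ∈ U ∧ ∃ (ι : Type) (s : Finset ι)
    (l : ι → ConvFn n) (g : ConvFn n), s.card ≤ n + 1 ∧ (∀ i, l i ∈ affSet n) ∧ IsMx s l g ∧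
    ∀ y ∈ U, f.1 y = g.1 y

lemma good_of_generic {ι : Type} [Fintype ι] (c : ι → ℝ) (v : ι → Eucl n)
    (hgen : ∀ S : Finset ι, ∀ (x : Eucl n) (z : ℝ), (∀ i ∈ S, c i + inner ℝ (v i) x = z) →
        S.card ≤ n + 1) (f : ConvFn n) (hf : IsMx Finset.univ (fun i => aff (c i) (v i)) f) :
    Good f := by
  classical
  intro x
  set l : ι → ConvFn n := fun i => aff (c i) (v i) with hl
  let A : Finset ι := Finset.univ.filter fun i => (l i).1 x = f.1 x
  have hA : A.Nonempty := by
    obtain ⟨i, _, hi⟩ := hf.2 x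
    exact ⟨i, by simp [A, hi]⟩
  obtain ⟨g, hg⟩ := exists_mx A hA l
  have hgf : ∀ y, g.1 y ≤ f.1 y := by
    intro y
    obtain ⟨i, hi, h⟩ := hg.2 y
    rw [h]; exact hf.1 i (Finset.mem_univ i) y
  refine ⟨⋂ i ∈ (Aᶜ : Finset ι), {y | (l i).1 y < g.1 y}, ?_, ?_, ι, A, l, g, ?_, ?_, hg, ?_⟩
  · apply isOpen_biInter_finset
    intro i _
    exact isOpen_lt (by fun_prop) (by fun_prop)
  · simp only [Set.mem_iInter]
    intro i hi
    have h1 : (l i).1 x ≠ f.1 x := by simpa [A] using hi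
    have h2 := hf.1 i (Finset.mem_univ i) x
    obtain ⟨j, hj⟩ := hA
    have h3 := hg.1 j hj x
    have h4 : (l j).1 x = f.1 x := by simpa [A] using hj
    have h5 : (l i).1 x < f.1 x := lt_of_le_of_ne h2 h1
    change (l i).1 x < g.1 x
    linarith
  · apply hgen A x (f.1 x)
    intro i hi
    have h4 : (l i).1 x = f.1 x := by simpa [A] using hi
    rw [← h4, hl, aff_apply]
  · intro i; exact ⟨_, _, rfl⟩
  · intro y hy
    refine le_antisymm ?_ (hgf y)
    obtain ⟨i, _, hi⟩ := hf.2 y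
    by_cases hiA : i ∈ A
    · rw [hi]; exact hg.1 i hiA y
    · simp only [Set.mem_iInter] at hy
      have : (l i).1 y < g.1 y := hy i (by simpa using hiA)
      rw [hi]; exact this.le

lemma exists_minorant (f : ConvFn n) (x : Eucl n) (ε : ℝ) (hε : 0 < ε) :
    ∃ (c : ℝ) (v : Eucl n), (∀ y, c + inner ℝ v y ≤ f.1 y) ∧ c + inner ℝ v x = f.1 x - ε := by
  obtain ⟨l, c, h1, h2⟩ := ConvexOn.exists_affine_le_of_lt (𝕜 := ℝ) (s := Set.univ) (φ := f.1)
    (x := x) (a := f.1 x - ε) (Set.mem_univ x) (by linarith) isClosed_univ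
    (f.1.continuous.lowerSemicontinuous.lowerSemicontinuousOn _) f.2
  refine ⟨c, (InnerProductSpace.toDual ℝ (Eucl n)).symm l, ?_, ?_⟩
  · intro y
    have := h1 ⟨y, Set.mem_univ y⟩
    rw [InnerProductSpace.toDual_symm_apply, add_comm]
    simpa using this
  · rw [InnerProductSpace.toDual_symm_apply, add_comm]
    simpa using h2

lemma exists_good_approx (f : ConvFn n) (K : Set (Eucl n)) (hK : IsCompact K) (ε : ℝ) (hε : 0 < ε) :
    ∃ g : ConvFn n, Good g ∧ ∀ x ∈ K, |g.1 x - f.1 x| < ε := by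
  classical
  choose c v h1 h2 using fun x => exists_minorant f x (ε / 3) (by linarith)
  obtain ⟨t, ht⟩ := hK.elim_finite_subcover (fun x => {y | f.1 y - ε / 2 < c x + inner ℝ (v x) y})
    (fun x => isOpen_lt (by fun_prop) (by fun_prop))
    (fun x _ => Set.mem_iUnion.2 ⟨x, by rw [Set.mem_ofPred_eq, h2]; linarith⟩)
  obtain ⟨c', hc', hgen⟩ := exists_generic (ι := Fin (insert 0 t).card)
    (fun i => c ((insert 0 t).equivFin.symm i)) (fun i => v ((insert 0 t).equivFin.symm i))
    (ε / 2) (by linarith)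
  have hne : (Finset.univ : Finset (Fin (insert 0 t).card)).Nonempty :=
    ⟨(insert 0 t).equivFin ⟨0, Finset.mem_insert_self _ _⟩, Finset.mem_univ _⟩
  obtain ⟨g, hg⟩ := exists_mx Finset.univ hne (fun i => aff (c' i) (v ((insert 0 t).equivFin.symm i)))
  refine ⟨g, good_of_generic _ _ hgen g hg, ?_⟩
  intro x hx
  rw [abs_lt]
  constructor
  · obtain ⟨y, hy, hxy⟩ := Set.mem_iUnion₂.1 (ht hx)
    have hxy : f.1 x - ε / 2 < c y + inner ℝ (v y) x := hxy
    have h3 := hg.1 ((insert 0 t).equivFin ⟨y, Finset.mem_insert_of_mem hy⟩) (Finset.mem_univ _) x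
    have h4 := hc' ((insert 0 t).equivFin ⟨y, Finset.mem_insert_of_mem hy⟩)
    rw [aff_apply] at h3
    simp only [Equiv.symm_apply_apply] at h3 h4
    rw [abs_lt] at h4
    linarith
  · obtain ⟨i, _, hi⟩ := hg.2 x
    have h4 := hc' i
    have h5 := h1 ((insert 0 t).equivFin.symm i) x
    rw [hi, aff_apply]
    rw [abs_lt] at h4
    linarith

lemma exists_good_seq (f : ConvFn n) : ∃ g : ℕ → ConvFn n, (∀ k, Good (g k)) ∧
    Filter.Tendsto g Filter.atTop (nhds f) := by
  choose g hg hgf using fun k : ℕ => exists_good_approx f (Metric.closedBall 0 k)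
    (isCompact_closedBall _ _) (1 / ((k : ℝ) + 1)) (by positivity)
  refine ⟨g, hg, ?_⟩
  rw [tendsto_subtype_rng, ContinuousMap.tendsto_iff_forall_isCompact_tendstoUniformlyOn]
  intro K hK
  rw [Metric.tendstoUniformlyOn_iff]
  intro ε hε
  obtain ⟨R, hR⟩ := hK.isBounded.subset_closedBall 0
  have e1 : ∀ᶠ k : ℕ in Filter.atTop, R ≤ (k : ℝ) :=
    tendsto_natCast_atTop_atTop.eventually_ge_atTop R
  have e2 : ∀ᶠ k : ℕ in Filter.atTop, 1 / ((k : ℝ) + 1) < ε :=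
    tendsto_one_div_add_atTop_nhds_zero_nat.eventually_lt_const hε
  filter_upwards [e1, e2] with k h1 h2 x hx
  rw [dist_comm, Real.dist_eq]
  exact (hgf k x (Metric.closedBall_subset_closedBall h1 (hR hx))).trans h2

end gen

section final
open Polynomial
variable {n : ℕ}

lemma continuous_smul_left (f : ConvFn n) : Continuous fun t : ℝ≥0 => smulConv t f := by
  apply Continuous.subtype_mk
  exact (NNReal.continuous_coe).smul continuous_const

lemma continuous_smul_right (t : ℝ≥0) : Continuous fun f : ConvFn n => smulConv t f := by
  apply Continuous.subtype_mk
  exact continuous_subtype_val.const_smul (t : ℝ)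

lemma smul_mem_aff (u : ℝ≥0) (l : ConvFn n) (h : l ∈ affSet n) : smulConv u l ∈ affSet n := by
  obtain ⟨s, v, rfl⟩ := h
  refine ⟨u * s, (u : ℝ) • v, ?_⟩
  apply conv_ext; intro x
  rw [smul_apply, aff_apply, aff_apply, real_inner_smul_left]; ring

lemma smul_isMx {ι : Type*} {s : Finset ι} {l : ι → ConvFn n} {f : ConvFn n} (h : IsMx s l f)
    (u : ℝ≥0) : IsMx s (fun i => smulConv u (l i)) (smulConv u f) := by
  refine ⟨fun i hi x => ?_, fun x => ?_⟩
  · rw [smul_apply, smul_apply]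
    exact mul_le_mul_of_nonneg_left (h.1 i hi x) u.2
  · obtain ⟨i, hi, hx⟩ := h.2 x
    exact ⟨i, hi, by rw [smul_apply, smul_apply, hx]⟩

lemma smul_smul' (t u : ℝ≥0) (f : ConvFn n) : smulConv t (smulConv u f) = smulConv (t * u) f := by
  apply conv_ext; intro x; simp only [smul_apply]; push_cast; ring

lemma one_smul' (f : ConvFn n) : smulConv 1 f = f := by
  apply conv_ext; intro x; simp [smul_apply]

/-- Lagrange basis -/
def lb (N j : ℕ) : ℂ[X] := Lagrange.basis (Finset.range (N + 1)) (fun j : ℕ => (j : ℂ)) j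

lemma inj (N : ℕ) : Set.InjOn (fun j : ℕ => (j : ℂ)) (Finset.range (N + 1)) :=
  fun _ _ _ _ h => Nat.cast_injective h

lemma lb_natDegree (N j : ℕ) (hj : j ∈ Finset.range (N + 1)) : (lb N j).natDegree < N + 1 := by
  have := Lagrange.natDegree_basis (inj N) hj
  rw [lb, this]; simp

lemma interp_of_poly (G : ℝ≥0 → ℂ) (N : ℕ) (p : ℂ[X]) (hp : p.degree < (N + 1 : ℕ))
    (h : ∀ t : ℝ≥0, G t = p.eval ((t : ℝ) : ℂ)) (t : ℝ≥0) :
    G t = ∑ j ∈ Finset.range (N + 1), (lb N j).eval ((t : ℝ) : ℂ) * G j := by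
  have e := Lagrange.eq_interpolate (inj N) (f := p) (by simpa using hp)
  rw [h t, e, Lagrange.interpolate_apply, eval_finsetSum]
  apply Finset.sum_congr rfl
  intro j _
  rw [eval_mul, eval_C, h j, mul_comm]
  simp [lb]

lemma interp_mx {d : ℕ} {Ψ : ConvFn n → RadonMeasure n} (hΨ : MemPdLV d Ψ)
    {ι : Type*} (s : Finset ι) (hs : s.card ≤ n + 1) (l : ι → ConvFn n) (hl : ∀ i, l i ∈ affSet n)
    (f : ConvFn n) (hf : IsMx s l f) (φ : C_c(Eucl n, ℂ)) (t : ℝ≥0) :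
    (Ψ (smulConv t f)).1 φ = ∑ j ∈ Finset.range (n + d + 1),
      (lb (n + d) j).eval ((t : ℝ) : ℂ) * (Ψ (smulConv j f)).1 φ := by
  obtain ⟨p, hp, h⟩ := real_poly (fun t => (Ψ (smulConv t f)).1 φ)
    ((hΨ.2.1 φ).comp (continuous_smul_left f)) (n + d) (by
      intro u
      obtain ⟨p, hp, h⟩ := nat_poly (evalL Ψ φ) (smulConv u f) (n + d)
        (iter_zero' hΨ s hs _ (fun i => smul_mem_aff u _ (hl i)) _ (smul_isMx hf u) φ)
      refine ⟨p, hp, fun k => ?_⟩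
      rw [← h k, evalL_apply]
      congr 3
      apply conv_ext; intro x
      rw [nsmul_apply, smul_apply, smul_apply]; push_cast; ring)
  exact interp_of_poly (fun t => (Ψ (smulConv t f)).1 φ) (n + d) p hp h t

lemma interp_good {d : ℕ} {Ψ : ConvFn n → RadonMeasure n} (hΨ : MemPdLV d Ψ)
    (f : ConvFn n) (hf : Good f) (φ : C_c(Eucl n, ℂ)) (t : ℝ≥0) :
    (Ψ (smulConv t f)).1 φ = ∑ j ∈ Finset.range (n + d + 1),
      (lb (n + d) j).eval ((t : ℝ) : ℂ) * (Ψ (smulConv j f)).1 φ := by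
  let L : C_c(Eucl n, ℂ) →ₗ[ℂ] ℂ := (Ψ (smulConv t f)).1 - ∑ j ∈ Finset.range (n + d + 1),
      (lb (n + d) j).eval ((t : ℝ) : ℂ) • (Ψ (smulConv j f)).1
  have hL : ∀ φ, L φ = (Ψ (smulConv t f)).1 φ - ∑ j ∈ Finset.range (n + d + 1),
      (lb (n + d) j).eval ((t : ℝ) : ℂ) * (Ψ (smulConv j f)).1 φ := by
    intro φ; simp [L, LinearMap.sum_apply]
  have : L = 0 := by
    apply local_zero
    intro x
    obtain ⟨U, hU, hx, ι, s, l, g, hs, hl, hg, hfg⟩ := hf x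
    refine ⟨U, hU, hx, fun φ hφ => ?_⟩
    have e : ∀ t : ℝ≥0, (Ψ (smulConv t f)).1 φ = (Ψ (smulConv t g)).1 φ := fun t =>
      hΨ.1 _ _ U hU (fun y hy => by rw [smul_apply, smul_apply, hfg y hy]) φ hφ
    rw [hL]
    simp only [e]
    rw [interp_mx hΨ s hs l hl g hg φ t, sub_self]
  rw [← sub_eq_zero, ← hL, this]; rfl

lemma interp_all {d : ℕ} {Ψ : ConvFn n → RadonMeasure n} (hΨ : MemPdLV d Ψ)
    (f : ConvFn n) (φ : C_c(Eucl n, ℂ)) (t : ℝ≥0) :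
    (Ψ (smulConv t f)).1 φ = ∑ j ∈ Finset.range (n + d + 1),
      (lb (n + d) j).eval ((t : ℝ) : ℂ) * (Ψ (smulConv j f)).1 φ := by
  obtain ⟨g, hg, hgf⟩ := exists_good_seq f
  have c1 : ∀ t, Continuous fun f => (Ψ (smulConv t f)).1 φ := fun t =>
    (hΨ.2.1 φ).comp (continuous_smul_right t)
  have c2 : Continuous fun f => ∑ j ∈ Finset.range (n + d + 1),
      (lb (n + d) j).eval ((t : ℝ) : ℂ) * (Ψ (smulConv j f)).1 φ :=
    continuous_finsetSum _ fun j _ => continuous_const.mul (c1 j)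
  refine tendsto_nhds_unique (((c1 t).tendsto f).comp hgf) ((((c2).tendsto f).comp hgf).congr ?_)
  intro k
  exact (interp_good hΨ (g k) (hg k) φ t).symm

/-- the components -/
def ZZ (d : ℕ) (Ψ : ConvFn n → RadonMeasure n) (k : Fin (n + d + 1)) (f : ConvFn n) :
    RadonMeasure n :=
  ∑ j ∈ Finset.range (n + d + 1), (lb (n + d) j).coeff k • Ψ (smulConv j f)

lemma ZZ_apply (d : ℕ) (Ψ : ConvFn n → RadonMeasure n) (k : Fin (n + d + 1)) (f : ConvFn n)
    (φ : C_c(Eucl n, ℂ)) : (ZZ d Ψ k f).1 φ =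
    ∑ j ∈ Finset.range (n + d + 1), (lb (n + d) j).coeff k * (Ψ (smulConv j f)).1 φ := by
  simp [ZZ, LinearMap.sum_apply]

lemma radon_ext {μ ν : RadonMeasure n} (h : ∀ φ, μ.1 φ = ν.1 φ) : μ = ν :=
  Subtype.ext (LinearMap.ext h)

lemma sum_val {ι : Type*} [Fintype ι] (c : ι → ℂ) (Z : ι → RadonMeasure n) (φ : C_c(Eucl n, ℂ)) :
    (∑ k, c k • Z k).1 φ = ∑ k, c k * (Z k).1 φ := by
  simp [LinearMap.sum_apply]

lemma ZZ_expand {d : ℕ} {Ψ : ConvFn n → RadonMeasure n} (hΨ : MemPdLV d Ψ) (f : ConvFn n)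
    (t : ℝ≥0) : Ψ (smulConv t f) = ∑ k : Fin (n + d + 1), ((t : ℝ) : ℂ) ^ (k : ℕ) • ZZ d Ψ k f := by
  apply radon_ext; intro φ
  rw [sum_val, interp_all hΨ f φ t]
  simp only [ZZ_apply, Finset.mul_sum]
  rw [Finset.sum_comm]
  apply Finset.sum_congr rfl
  intro j hj
  rw [eval_eq_sum_range' (lb_natDegree _ j hj), Finset.sum_range, Finset.sum_mul]
  apply Finset.sum_congr rfl
  intro k _
  ring

lemma coeff_unique {m : ℕ} (a b : Fin m → RadonMeasure n)
    (h : ∀ t : ℝ≥0, ∑ k : Fin m, ((t : ℝ) : ℂ) ^ (k : ℕ) • a k = ∑ k : Fin m, ((t : ℝ) : ℂ) ^ (k : ℕ) • b k) :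
    a = b := by
  funext k
  apply radon_ext; intro φ
  let p : (Fin m → RadonMeasure n) → ℂ[X] := fun a => ∑ k : Fin m, monomial (k : ℕ) ((a k).1 φ)
  have hp : p a = p b := by
    apply Polynomial.eq_of_infinite_eval_eq
    refine Set.Infinite.mono (s := Set.range (fun k : ℕ => (k : ℂ))) ?_
      (Set.infinite_range_of_injective Nat.cast_injective)
    rintro _ ⟨j, rfl⟩
    have := congrArg (fun μ : RadonMeasure n => μ.1 φ) (h j)
    simp only [sum_val] at this
    simpa [p, eval_finsetSum, mul_comm] using this
  have hc : ∀ a, (p a).coeff k = (a k).1 φ := by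
    intro a
    simp only [p, finsetSum_coeff, coeff_monomial]
    rw [Finset.sum_eq_single k]
    · simp
    · intro i _ hi
      rw [if_neg (fun h => hi (Fin.ext h))]
    · simp
  rw [← hc a, ← hc b, hp]

lemma ZZ_mem {d : ℕ} {Ψ : ConvFn n → RadonMeasure n} (hΨ : MemPdLV d Ψ) (k : Fin (n + d + 1)) :
    MemPdLV d (ZZ d Ψ k) := by
  refine ⟨?_, ?_, ?_⟩
  · intro f h U hU hfh φ hφ
    rw [ZZ_apply, ZZ_apply]
    apply Finset.sum_congr rfl
    intro j _
    rw [hΨ.1 (smulConv j f) (smulConv j h) U hU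
      (fun x hx => by rw [smul_apply, smul_apply, hfh x hx]) φ hφ]
  · intro φ
    simp only [ZZ_apply]
    exact continuous_finsetSum _ fun j _ =>
      continuous_const.mul ((hΨ.2.1 φ).comp (continuous_smul_right _))
  · intro f φ
    have h1 : ∀ j : ℕ, ∃ P : MvPolynomial (Fin (n + 1)) ℂ, P.totalDegree ≤ d ∧
        ∀ (s : ℝ) (v : Eucl n), (Ψ (smulConv j (addAffine f s v))).1 φ =
          MvPolynomial.eval (Fin.cons (s : ℂ) fun i => (v i : ℂ)) P := by
      intro j
      obtain ⟨P, hP, h⟩ := hΨ.2.2 (smulConv j f) φ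
      obtain ⟨Q, hQ, hQP⟩ := exists_rescale ((j : ℝ) : ℂ) P d hP
      refine ⟨Q, hQ, fun s v => ?_⟩
      rw [hQP, ← cons_smul, ← h]
      congr 3
      apply conv_ext; intro x
      rw [addAffine_eq, addAffine_eq, smul_apply, add_apply, add_apply, aff_apply, aff_apply,
        smul_apply, real_inner_smul_left]
      push_cast; ring
    choose P hP h using h1
    refine ⟨∑ j ∈ Finset.range (n + d + 1), MvPolynomial.C ((lb (n + d) j).coeff k) * P j, ?_, ?_⟩
    · apply MvPolynomial.totalDegree_finsetSum_le
      intro j _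
      refine (MvPolynomial.totalDegree_mul _ _).trans ?_
      simpa using hP j
    · intro s v
      rw [ZZ_apply, map_sum]
      apply Finset.sum_congr rfl
      intro j _
      rw [h, map_mul, MvPolynomial.eval_C]

end final

end HomDec

/-- **homogeneous decomposition.** -/
theorem homogeneous_decomposition {n d : ℕ} (Ψ : ConvFn n → RadonMeasure n)
    (hΨ : MemPdLV d Ψ) :
    ∃! Z : Fin (n + d + 1) → ConvFn n → RadonMeasure n,
      (∀ k : Fin (n + d + 1), MemPdLV d (Z k) ∧ IsHomogeneousDeg (k : ℕ) (Z k)) ∧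
      (∀ f : ConvFn n, Ψ f = ∑ k, Z k f) ∧
      (∀ (f : ConvFn n) (t : ℝ≥0),
        Ψ (smulConv t f) = ∑ k : Fin (n + d + 1), ((t : ℝ) : ℂ) ^ (k : ℕ) • Z k f) := by
  refine ⟨HomDec.ZZ d Ψ, ⟨fun k => ⟨HomDec.ZZ_mem hΨ k, ?_⟩, ?_, HomDec.ZZ_expand hΨ⟩, ?_⟩
  · intro f u
    have := HomDec.coeff_unique (fun k => HomDec.ZZ d Ψ k (smulConv u f))
      (fun k => ((u : ℝ) : ℂ) ^ (k : ℕ) • HomDec.ZZ d Ψ k f) (by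
        intro t
        rw [← HomDec.ZZ_expand hΨ, HomDec.smul_smul', HomDec.ZZ_expand hΨ]
        apply Finset.sum_congr rfl
        intro k _
        rw [smul_smul]
        push_cast
        rw [mul_pow])
    exact congrFun this k
  · intro f
    have := HomDec.ZZ_expand hΨ f 1
    rw [HomDec.one_smul'] at this
    simpa using this
  · rintro Z ⟨_, _, hZ⟩
    funext k f
    have := HomDec.coeff_unique (fun k => Z k f) (fun k => HomDec.ZZ d Ψ k f) (by
      intro t
      rw [← hZ, ← HomDec.ZZ_expand hΨ])
    exact congrFun this k

end
end
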